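/- Fix l with 0 ≤ l < n−1 and indices j ≠ k. Let w = (e_j − e_k)ᵀ Π^{−1/2} U ∈ ℝⁿ and let D_l(j,k)² = Σ_{r=0}^{l} σ_r² w_r² denote the squared Euclidean distance between the truncated embeddings using only the first l+1 singular pairs. Then 0 ≤ D(j,k)² − D_l(j,k)² ≤ σ_{l+1}² · (1/π_j + 1/π_k); that is, the truncated time coupled diffusion map preserves the time coupled diffusion distance up to an error controlled by σ_{l+1}. -/

import Mathlib

open Matrix Finset

/-- The truncated time coupled diffusion map using the first `l+1` singular
pairs preserves the time coupled diffusion distance up to an error controlled by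
`σ_{l+1}`: `0 ≤ D(j,k)² − D_l(j,k)² ≤ σ_{l+1}² (1/π_j + 1/π_k)`. -/
theorem truncated_time_coupled_diffusion_map_error
    (n : ℕ) (hn : 1 ≤ n)
    (P : Matrix (Fin n) (Fin n) ℝ)
    (hP_nonneg : ∀ i j, 0 ≤ P i j)
    (hP_row : ∀ i, ∑ j, P i j = 1)
    (π : Fin n → ℝ)
    (hπ_pos : ∀ i, 0 < π i)
    (hπ_stat : ∀ j, ∑ i, π i * P i j = π j)
    (U V : Matrix (Fin n) (Fin n) ℝ)
    (σ : Fin n → ℝ)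
    (hU : U * Uᵀ = 1 ∧ Uᵀ * U = 1)
    (hV : V * Vᵀ = 1 ∧ Vᵀ * V = 1)
    (hσ_nonneg : ∀ i, 0 ≤ σ i)
    (hσ_anti : ∀ i j : Fin n, i ≤ j → σ j ≤ σ i)
    (hSVD : Matrix.diagonal (fun i => Real.sqrt (π i)) * P *
        Matrix.diagonal (fun i => (Real.sqrt (π i))⁻¹) = U * Matrix.diagonal σ * Vᵀ)
    (l : ℕ) (hl : l + 1 < n)
    (j k : Fin n) (hjk : j ≠ k)
    (w : Fin n → ℝ)
    (hw : w = fun r => (Real.sqrt (π j))⁻¹ * U j r - (Real.sqrt (π k))⁻¹ * U k r) :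
    0 ≤ (∑ r, (P j r - P k r) ^ 2 / π r) -
        (∑ r ∈ Finset.univ.filter (fun r : Fin n => (r : ℕ) ≤ l), σ r ^ 2 * w r ^ 2) ∧
    (∑ r, (P j r - P k r) ^ 2 / π r) -
        (∑ r ∈ Finset.univ.filter (fun r : Fin n => (r : ℕ) ≤ l), σ r ^ 2 * w r ^ 2) ≤
      σ ⟨l + 1, hl⟩ ^ 2 * (1 / π j + 1 / π k) := by
  have hs : ∀ i, 0 < Real.sqrt (π i) := fun i => Real.sqrt_pos.2 (hπ_pos i)
  have hs2 : ∀ i, Real.sqrt (π i) ^ 2 = π i := fun i => Real.sq_sqrt (hπ_pos i).le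
  -- entries of the singular value decomposition
  have hent : ∀ i r, P i r * (Real.sqrt (π r))⁻¹ =
      (Real.sqrt (π i))⁻¹ * ∑ s, U i s * σ s * V r s := by
    intro i r
    have h := congrFun (congrFun hSVD i) r
    rw [Matrix.mul_diagonal, Matrix.diagonal_mul, Matrix.mul_apply] at h
    simp only [Matrix.mul_diagonal, Matrix.transpose_apply] at h
    rw [← h, mul_assoc (Real.sqrt (π i)), inv_mul_cancel_left₀ (hs i).ne']
  have hx : ∀ r, (P j r - P k r) ^ 2 / π r = ((V *ᵥ fun s => σ s * w s) r) ^ 2 := by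
    intro r
    have h : (V *ᵥ fun s => σ s * w s) r = (P j r - P k r) * (Real.sqrt (π r))⁻¹ := by
      rw [sub_mul, hent, hent, Finset.mul_sum, Finset.mul_sum, ← Finset.sum_sub_distrib]
      simp only [Matrix.mulVec, dotProduct, hw]
      refine Finset.sum_congr rfl fun s _ => ?_
      ring
    rw [h, mul_pow, inv_pow, hs2, div_eq_mul_inv]
  have hD : (∑ r, (P j r - P k r) ^ 2 / π r) = ∑ r, σ r ^ 2 * w r ^ 2 := by
    have h : (V *ᵥ fun s => σ s * w s) ⬝ᵥ (V *ᵥ fun s => σ s * w s)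
        = (fun s => σ s * w s) ⬝ᵥ (fun s => σ s * w s) := by
      rw [Matrix.dotProduct_mulVec, Matrix.vecMul_mulVec, hV.2, Matrix.vecMul_one]
    simp only [hx]
    simp only [dotProduct] at h
    simp only [pow_two]
    rw [h]
    refine Finset.sum_congr rfl fun s _ => ?_
    ring
  have hUU : ∀ a b, ∑ r, U a r * U b r = if a = b then 1 else 0 := by
    intro a b
    have h := congrFun (congrFun hU.1 a) b
    rwa [Matrix.mul_apply, Matrix.one_apply] at h
  have hW : ∑ r, w r ^ 2 = 1 / π j + 1 / π k := by
    have h : ∀ r, w r ^ 2 = (π j)⁻¹ * (U j r * U j r) + (π k)⁻¹ * (U k r * U k r)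
        - 2 * (Real.sqrt (π j))⁻¹ * (Real.sqrt (π k))⁻¹ * (U j r * U k r) := by
      intro r
      rw [hw, ← hs2 j, ← hs2 k, Real.sqrt_sq (hs j).le, Real.sqrt_sq (hs k).le]
      ring
    simp only [h, Finset.sum_sub_distrib, Finset.sum_add_distrib, ← Finset.mul_sum, hUU]
    simp [hjk]
  have hsplit := Finset.sum_filter_add_sum_filter_not Finset.univ
    (fun r : Fin n => (r : ℕ) ≤ l) (fun r => σ r ^ 2 * w r ^ 2)
  rw [hD, ← hsplit, add_sub_cancel_left]
  refine ⟨Finset.sum_nonneg fun r _ => by positivity, ?_⟩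
  rw [← hW, Finset.mul_sum]
  refine le_trans (Finset.sum_le_sum (g := fun r => σ ⟨l + 1, hl⟩ ^ 2 * w r ^ 2) ?_)
    (Finset.sum_le_sum_of_subset_of_nonneg (Finset.filter_subset _ _)
      fun r _ _ => by positivity)
  intro r hr
  have hr' : l + 1 ≤ (r : ℕ) := by
    have := (Finset.mem_filter.1 hr).2
    omega
  have h1 : σ r ≤ σ ⟨l + 1, hl⟩ := hσ_anti _ _ hr'
  have h2 := hσ_nonneg r
  gcongr
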